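/- arXiv:2011.05432 — 12 statements merged into one kernel-verified Lean document; each statement's English description precedes it below -/
import Mathlib

section
/- Let k ∈ ℤ and let n ≥ 1 be an integer. (a) If n is odd, then [k]_s·[n]_s = Σ_{i=0}^{n−1} [k−n+1+2i]_s and [k]_t·[n]_t = Σ_{i=0}^{n−1} [k−n+1+2i]_t. (b) If both k and n are even, then [k]_s·[n]_t = Σ_{i=0}^{n−1} [k−n+1+2i]_s (all indices k−n+1+2i occurring in this sum are odd, so the coloring of the summands is immaterial). -/
/-- Both colors satisfy the same recursion in steps of two. -/
theorem twoColor_step_two {K : Type*} [CommRing K] {xs xt : K} {qs qt : ℤ → K}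
    (hrecs : ∀ n : ℤ, qs (n + 1) = xs * qt n - qs (n - 1))
    (hrect : ∀ n : ℤ, qt (n + 1) = xt * qs n - qt (n - 1)) (m : ℤ) :
    qs (m + 2) = (xs * xt - 2) * qs m - qs (m - 2) := by
  have h1 := hrecs (m + 1)
  have h2 := hrect m
  have h3 := hrecs (m - 1)
  rw [show m + 1 + 1 = m + 2 by ring, show m + 1 - 1 = m by ring] at h1
  rw [show m - 1 + 1 = m by ring, show m - 1 - 1 = m - 2 by ring] at h3
  linear_combination h1 + xs * h2 + h3

/-- At even indices the two colors are proportional, at odd indices they agree. -/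
theorem twoColor_compare {K : Type*} [CommRing K] {xs xt : K} {qs qt : ℤ → K}
    (hqs0 : qs 0 = 0) (hqt0 : qt 0 = 0) (hqs1 : qs 1 = 1) (hqt1 : qt 1 = 1)
    (hrecs : ∀ n : ℤ, qs (n + 1) = xs * qt n - qs (n - 1))
    (hrect : ∀ n : ℤ, qt (n + 1) = xt * qs n - qt (n - 1)) (j : ℤ) :
    xt * qs (2 * j) = xs * qt (2 * j) ∧ qs (2 * j + 1) = qt (2 * j + 1) := by
  induction j with
  | zero => simp [hqs0, hqt0, hqs1, hqt1]
  | succ i ih =>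
    obtain ⟨h1, h2⟩ := ih
    have hs1 := hrecs (2 * i + 1)
    have ht1 := hrect (2 * i + 1)
    have hs2 := hrecs (2 * (i + 1))
    have ht2 := hrect (2 * (i + 1))
    rw [show (2 * i + 1 + 1 : ℤ) = 2 * (i + 1) by ring, add_sub_cancel_right] at hs1 ht1
    rw [show (2 * (i + 1) - 1 : ℤ) = 2 * i + 1 by ring] at hs2 ht2
    have h : xt * qs (2 * ((i : ℤ) + 1)) = xs * qt (2 * (i + 1)) := by
      linear_combination xt * hs1 - xs * ht1 - xs * xt * h2 - h1
    exact ⟨h, by linear_combination hs2 - ht2 - h - h2⟩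
  | pred i ih =>
    obtain ⟨h1, h2⟩ := ih
    have hs1 := hrecs (2 * (-i))
    have ht1 := hrect (2 * (-i))
    have hs2 := hrecs (2 * (-i - 1) + 1)
    have ht2 := hrect (2 * (-i - 1) + 1)
    rw [show (2 * (-i) - 1 : ℤ) = 2 * (-i - 1) + 1 by ring] at hs1 ht1
    rw [show (2 * (-i - 1) + 1 + 1 : ℤ) = 2 * (-i) by ring, add_sub_cancel_right] at hs2 ht2
    have h : qs (2 * (-(i : ℤ) - 1) + 1) = qt (2 * (-i - 1) + 1) := by
      linear_combination hs1 - ht1 - h1 - h2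
    exact ⟨by linear_combination xt * hs2 - xs * ht2 - h1 - xs * xt * h, h⟩

/-- A product-to-sum identity between solutions of `f (m + 2) = c * f m - f (m - 2)` propagates
from two initial values. -/
theorem mul_sub_eq_add_of_step_two {K : Type*} [CommRing K] {c : K} {f q : ℤ → K}
    (hf : ∀ m, f (m + 2) = c * f m - f (m - 2)) (hq : ∀ m, q (m + 2) = c * q m - q (m - 2))
    {k a : ℤ} (h0 : f k * (q (a + 1) - q (a - 1)) = f (k - a) + f (k + a))
    (h1 : f k * (q (a + 3) - q (a + 1)) = f (k - a - 2) + f (k + a + 2)) (j : ℕ) :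
    f k * (q (a + 2 * j + 1) - q (a + 2 * j - 1)) = f (k - a - 2 * j) + f (k + a + 2 * j) := by
  induction j using Nat.twoStepInduction with
  | zero => simpa using h0
  | one =>
    simpa [show a + 2 + 1 = a + 3 by ring, show a + 2 - 1 = a + 1 by ring] using h1
  | more j ih1 ih2 =>
    push_cast at ih1 ih2 ⊢
    have e1 := hq (a + 2 * (j + 1) + 1)
    have e2 := hq (a + 2 * (j + 1) - 1)
    have e3 := hf (k - a - 2 * (j + 1))
    have e4 := hf (k + a + 2 * (j + 1))
    ring_nf at ih1 ih2 e1 e2 e3 e4 ⊢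
    linear_combination c * ih2 - ih1 + f k * e1 - f k * e2 - e3 - e4

/-- Enlarging a symmetric sum in steps of two by one term at each end. -/
theorem sum_range_add_two_symm {K : Type*} [AddCommMonoid K] (f : ℤ → K) (k : ℤ) (n : ℕ) :
    ∑ i ∈ Finset.range (n + 2), f (k - ((n + 2 : ℕ) : ℤ) + 1 + 2 * (i : ℤ)) =
      ∑ i ∈ Finset.range n, f (k - (n : ℤ) + 1 + 2 * (i : ℤ)) +
        (f (k - n - 1) + f (k + n + 1)) := by
  rw [Finset.sum_range_succ, Finset.sum_range_succ', add_assoc]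
  congr 1
  · refine Finset.sum_congr rfl fun i _ => congrArg f ?_
    push_cast
    ring
  · congr 2 <;> push_cast <;> ring

/-- The odd case of the product expansion, for one color. -/
theorem twoColor_mul_odd {K : Type*} [CommRing K] {c : K} {f : ℤ → K}
    (hf : ∀ m, f (m + 2) = c * f m - f (m - 2)) (h1 : f 1 = 1) (hneg : f (-1) = -1)
    (k : ℤ) (j : ℕ) :
    f k * f ((2 * j + 1 : ℕ) : ℤ) =
      ∑ i ∈ Finset.range (2 * j + 1), f (k - ((2 * j + 1 : ℕ) : ℤ) + 1 + 2 * (i : ℤ)) := by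
  induction j with
  | zero => simp [h1]
  | succ j ih =>
    have h3 := hf 1
    norm_num [h1, hneg] at h3
    have hD := mul_sub_eq_add_of_step_two hf hf (k := k) (a := 0)
      (by norm_num [h1, hneg]; ring)
      (by norm_num [h1, h3]; linear_combination -hf k) (j + 1)
    rw [show 2 * (j + 1) + 1 = 2 * j + 1 + 2 by ring, sum_range_add_two_symm, ← ih]
    push_cast at hD ⊢
    ring_nf at hD ⊢
    linear_combination hD

/-- The even case of the product expansion. -/
theorem twoColor_mul_even {K : Type*} [CommRing K] {c : K} {f q : ℤ → K}
    (hf : ∀ m, f (m + 2) = c * f m - f (m - 2)) (hq : ∀ m, q (m + 2) = c * q m - q (m - 2))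
    (hq0 : q 0 = 0) {k : ℤ} (hk : f k * q 2 = f (k - 1) + f (k + 1)) (j : ℕ) :
    f k * q ((2 * j : ℕ) : ℤ) =
      ∑ i ∈ Finset.range (2 * j), f (k - ((2 * j : ℕ) : ℤ) + 1 + 2 * (i : ℤ)) := by
  induction j with
  | zero => simp [hq0]
  | succ j ih =>
    have h2 := hq 0
    norm_num [hq0] at h2
    have hD := mul_sub_eq_add_of_step_two hf hq (k := k) (a := -1)
      (by norm_num [hq0, ← sub_eq_add_neg]; linear_combination hk - f k * h2)
      (by
        norm_num [hq0]
        rw [show k + 1 - 2 = k - 1 by ring, show k + -1 + 2 = k + 1 by ring, hk]) (j + 1)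
    rw [show 2 * (j + 1) = 2 * j + 2 by ring, sum_range_add_two_symm, ← ih]
    push_cast at hD ⊢
    ring_nf at hD ⊢
    linear_combination hD

/-- Product formulas for two-colored quantum numbers: for `k ∈ ℤ` and `n ≥ 1`,
(a) if `n` is odd then `[k]_s·[n]_s = Σ_{i=0}^{n-1} [k-n+1+2i]_s` and
    `[k]_t·[n]_t = Σ_{i=0}^{n-1} [k-n+1+2i]_t`;
(b) if `k` and `n` are both even then `[k]_s·[n]_t = Σ_{i=0}^{n-1} [k-n+1+2i]_s`. -/
theorem twoColorQuantum_mul_expand {K : Type*} [CommRing K] (xs xt : K) (qs qt : ℤ → K)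
    (hqs0 : qs 0 = 0) (hqt0 : qt 0 = 0) (hqs1 : qs 1 = 1) (hqt1 : qt 1 = 1)
    (hrecs : ∀ n : ℤ, qs (n + 1) = xs * qt n - qs (n - 1))
    (hrect : ∀ n : ℤ, qt (n + 1) = xt * qs n - qt (n - 1))
    (k : ℤ) (n : ℕ) (hn : 1 ≤ n) :
    (Odd n →
      qs k * qs (n : ℤ) = ∑ i ∈ Finset.range n, qs (k - (n : ℤ) + 1 + 2 * (i : ℤ)) ∧
      qt k * qt (n : ℤ) = ∑ i ∈ Finset.range n, qt (k - (n : ℤ) + 1 + 2 * (i : ℤ))) ∧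
    (Even k → Even n →
      qs k * qt (n : ℤ) = ∑ i ∈ Finset.range n, qs (k - (n : ℤ) + 1 + 2 * (i : ℤ))) := by
  have hs := twoColor_step_two hrecs hrect
  have ht : ∀ m, qt (m + 2) = (xs * xt - 2) * qt m - qt (m - 2) := fun m => by
    rw [mul_comm xs xt]
    exact twoColor_step_two hrect hrecs m
  have hsneg := hrecs 0
  have htneg := hrect 0
  have ht2 := hrect 1
  norm_num [hqs0, hqt0, hqs1, hqt1] at hsneg htneg ht2
  refine ⟨?_, ?_⟩
  · rintro ⟨j, rfl⟩
    exact ⟨twoColor_mul_odd hs hqs1 (by linear_combination hsneg) k j,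
      twoColor_mul_odd ht hqt1 (by linear_combination htneg) k j⟩
  · intro hk hn'
    obtain ⟨l, rfl⟩ := hk.two_dvd
    obtain ⟨j, rfl⟩ := hn'.two_dvd
    refine twoColor_mul_even hs ht hqt0 ?_ j
    have h := (twoColor_compare hqs0 hqt0 hqs1 hqt1 hrecs hrect l).1
    linear_combination h - hrecs (2 * l) + qs (2 * l) * ht2
end

section
/- If k and n are positive integers and k divides n, then the two-colored quantum number [k]_s divides [n]_s, and [k]_t divides [n]_t, in the polynomial ring ℤ[x_s, x_t]. -/
open MvPolynomial

section TwoColorRecursion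

variable {R : Type*} [CommRing R] {x y : R} {a b : ℤ → R}

/-- Two-colored quantum numbers of odd index do not depend on the color, and those of even
index are proportional to `x` and `y`. -/
theorem twoColor_odd_eq_and_even_proportional (ha0 : a 0 = 0) (hb0 : b 0 = 0)
    (ha1 : a 1 = 1) (hb1 : b 1 = 1)
    (ha : ∀ n : ℤ, a (n + 1) = x * b n - a (n - 1))
    (hb : ∀ n : ℤ, b (n + 1) = y * a n - b (n - 1)) (i : ℕ) :
    a (2 * i + 1) = b (2 * i + 1) ∧ y * a (2 * i) = x * b (2 * i) := by
  induction i with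
  | zero => simp [ha0, hb0, ha1, hb1]
  | succ i ih =>
    obtain ⟨hodd, heven⟩ := ih
    have ha2 := ha (2 * i + 1)
    have hb2 := hb (2 * i + 1)
    have ha3 := ha (2 * i + 1 + 1)
    have hb3 := hb (2 * i + 1 + 1)
    simp only [add_sub_cancel_right] at ha2 hb2 ha3 hb3
    have hidx : (2 * ((i + 1 : ℕ) : ℤ)) = 2 * i + 1 + 1 := by push_cast; ring
    rw [hidx]
    have hprop : y * a (2 * i + 1 + 1) = x * b (2 * i + 1 + 1) := by
      rw [ha2, hb2]
      linear_combination -heven - x * y * hodd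
    refine ⟨?_, hprop⟩
    rw [ha3, hb3]
    linear_combination -hprop - hodd

/-- Addition formula for two-colored quantum numbers, for a shift by an even and by an odd
index. -/
theorem twoColor_add (ha0 : a 0 = 0) (hb0 : b 0 = 0) (hb1 : b 1 = 1) (ha1 : a 1 = 1)
    (ha : ∀ n : ℤ, a (n + 1) = x * b n - a (n - 1))
    (hb : ∀ n : ℤ, b (n + 1) = y * a n - b (n - 1)) (m : ℤ) (i : ℕ) :
    a (m + 2 * i) = b (m + 1) * a (2 * i) - a m * a (2 * i - 1) ∧
      b (m + (2 * i + 1)) = b (m + 1) * b (2 * i + 1) - a m * b (2 * i) := by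
  induction i with
  | zero =>
    have h := ha 0
    simp only [zero_add, zero_sub, ha1, hb0, mul_zero] at h
    constructor
    · simp only [Nat.cast_zero, mul_zero, add_zero, zero_sub, ha0]
      linear_combination a m * h
    · simp [hb0, hb1]
  | succ i ih =>
    obtain ⟨heven, hodd⟩ := ih
    have ha2 := ha (2 * i + 1)
    have hb2 := hb (2 * i + 1)
    have hb3 := hb (2 * i + 1 + 1)
    have ha1' := ha (2 * i)
    have hma := ha (m + (2 * i + 1))
    have hmb := hb (m + (2 * i + 1) + 1)
    rw [show m + (2 * (i : ℤ) + 1) - 1 = m + 2 * i by ring] at hma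
    simp only [add_sub_cancel_right] at ha2 hb2 hb3 hmb
    have hidx : (2 * ((i + 1 : ℕ) : ℤ)) = 2 * i + 1 + 1 := by push_cast; ring
    rw [hidx, add_sub_cancel_right, show m + (2 * (i : ℤ) + 1 + 1) = m + (2 * i + 1) + 1 by ring,
      show m + (2 * (i : ℤ) + 1 + 1 + 1) = m + (2 * i + 1) + 1 + 1 by ring]
    have hnext : a (m + (2 * i + 1) + 1) =
        b (m + 1) * a (2 * i + 1 + 1) - a m * a (2 * i + 1) := by
      rw [hma, ha2, hodd, heven, ha1']
      ring
    refine ⟨hnext, ?_⟩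
    rw [hmb, hnext, hb3, hodd, hb2]
    ring

/-- Each two-colored quantum number divides those of the same color whose index is a multiple. -/
theorem twoColor_dvd_mul (ha0 : a 0 = 0) (hb0 : b 0 = 0) (ha1 : a 1 = 1) (hb1 : b 1 = 1)
    (ha : ∀ n : ℤ, a (n + 1) = x * b n - a (n - 1))
    (hb : ∀ n : ℤ, b (n + 1) = y * a n - b (n - 1)) (k j : ℕ) :
    a k ∣ a (k * j) ∧ b k ∣ b (k * j) := by
  induction j with
  | zero => simp [ha0, hb0]
  | succ j ih =>
    obtain ⟨iha, ihb⟩ := ih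
    have hidx : (k : ℤ) * ((j + 1 : ℕ) : ℤ) = k * j + k := by push_cast; ring
    rw [hidx]
    generalize (k : ℤ) * j = m at iha ihb
    obtain ⟨i, rfl | rfl⟩ := k.even_or_odd'
    · push_cast at iha ihb ⊢
      rw [(twoColor_add ha0 hb0 hb1 ha1 ha hb m i).1, (twoColor_add hb0 ha0 ha1 hb1 hb ha m i).1]
      exact ⟨dvd_sub (dvd_mul_left _ _) (iha.mul_right _),
        dvd_sub (dvd_mul_left _ _) (ihb.mul_right _)⟩
    · push_cast at iha ihb ⊢
      rw [(twoColor_add ha0 hb0 hb1 ha1 ha hb m i).2, (twoColor_add hb0 ha0 ha1 hb1 hb ha m i).2]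
      have hodd := (twoColor_odd_eq_and_even_proportional ha0 hb0 ha1 hb1 ha hb i).1
      exact ⟨dvd_sub (dvd_mul_left _ _) ((hodd ▸ ihb).mul_right _),
        dvd_sub (dvd_mul_left _ _) ((hodd ▸ iha).mul_right _)⟩

end TwoColorRecursion

/-- In the polynomial ring `ℤ[x_s, x_t]`, if `k ∣ n` (with `k, n` positive) then the
two-colored quantum number `[k]_s` divides `[n]_s`, and `[k]_t` divides `[n]_t`. -/
theorem twoColorQuantum_dvd (qs qt : ℤ → MvPolynomial (Fin 2) ℤ)
    (hqs0 : qs 0 = 0) (hqt0 : qt 0 = 0) (hqs1 : qs 1 = 1) (hqt1 : qt 1 = 1)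
    (hrecs : ∀ n : ℤ, qs (n + 1) = X 0 * qt n - qs (n - 1))
    (hrect : ∀ n : ℤ, qt (n + 1) = X 1 * qs n - qt (n - 1))
    (k n : ℕ) (hk : 0 < k) (hn : 0 < n) (hdvd : k ∣ n) :
    qs (k : ℤ) ∣ qs (n : ℤ) ∧ qt (k : ℤ) ∣ qt (n : ℤ) := by
  obtain ⟨j, rfl⟩ := hdvd
  push_cast
  exact twoColor_dvd_mul hqs0 hqt0 hqs1 hqt1 hrecs hrect k j
end

section
/- For all integers 0 ≤ k ≤ n, the product [1]_s·[2]_s·⋯·[k]_s divides the product [n]_s·[n−1]_s·⋯·[n−k+1]_s in the polynomial ring ℤ[x_s, x_t] (i.e., the two-colored quantum binomial coefficient binom(n,k)_s is an element of ℤ[x_s, x_t]); the same holds with the coloring t in place of s. -/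
open MvPolynomial

/-- The sequences `qs`, `qt` are the two-colored quantum numbers for the parameters `x`, `y`. -/
structure IsTwoColorQuantum {R : Type*} [CommRing R] (x y : R) (qs qt : ℤ → R) : Prop where
  s_zero : qs 0 = 0
  t_zero : qt 0 = 0
  s_one : qs 1 = 1
  t_one : qt 1 = 1
  s_rec : ∀ n : ℤ, qs (n + 1) = x * qt n - qs (n - 1)
  t_rec : ∀ n : ℤ, qt (n + 1) = y * qs n - qt (n - 1)

namespace IsTwoColorQuantum

variable {R : Type*} [CommRing R] {x y : R} {qs qt : ℤ → R}

theorem symm (h : IsTwoColorQuantum x y qs qt) : IsTwoColorQuantum y x qt qs :=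
  ⟨h.t_zero, h.s_zero, h.t_one, h.s_one, h.t_rec, h.s_rec⟩

theorem s_add_two (h : IsTwoColorQuantum x y qs qt) (n : ℤ) :
    qs (n + 2) = x * qt (n + 1) - qs n := by
  have := h.s_rec (n + 1)
  rwa [add_sub_cancel_right, add_assoc, one_add_one_eq_two] at this

/-- Odd quantum numbers do not depend on the color, and even ones are proportional to the
parameter of their color. -/
theorem parity (h : IsTwoColorQuantum x y qs qt) (a : ℕ) :
    y * qs (2 * a) = x * qt (2 * a) ∧ qs (2 * a + 1) = qt (2 * a + 1) := by
  induction a with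
  | zero => simp [h.s_zero, h.t_zero, h.s_one, h.t_one]
  | succ a ih =>
    obtain ⟨he, ho⟩ := ih
    have hs := h.s_add_two (2 * a)
    have ht := h.symm.s_add_two (2 * a)
    have hs' := h.s_add_two (2 * a + 1)
    have ht' := h.symm.s_add_two (2 * a + 1)
    have e₁ : (2 * a + 1 + 1 : ℤ) = 2 * a + 2 := by ring
    have e₂ : (2 * (a + 1 : ℕ) : ℤ) = 2 * a + 2 := by push_cast; ring
    have e₃ : (2 * a + 2 + 1 : ℤ) = 2 * a + 1 + 2 := by ring
    rw [e₁] at hs' ht'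
    rw [e₂, e₃]
    have key : y * qs (2 * a + 2) = x * qt (2 * a + 2) := by
      linear_combination y * hs - x * ht - he - x * y * ho
    exact ⟨key, by linear_combination hs' - ht' - key - ho⟩

theorem s_odd_eq_t (h : IsTwoColorQuantum x y qs qt) {m : ℕ} (hm : Odd m) : qs m = qt m := by
  obtain ⟨a, rfl⟩ := hm
  exact_mod_cast (h.parity a).2

theorem s_even_proportional (h : IsTwoColorQuantum x y qs qt) {m : ℕ} (hm : Even m) :
    y * qs m = x * qt m := by
  obtain ⟨a, rfl⟩ := even_iff_two_dvd.mp hm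
  exact_mod_cast (h.parity a).1

/-- Addition formula with an even first summand, in both colors. -/
theorem add_even (h : IsTwoColorQuantum x y qs qt) {m : ℕ} (hm : Even m) (l : ℕ) :
    qs (m + l + 1) = qs (m + 1) * qs (l + 1) - qs m * qt l ∧
    qt (m + l + 1) = qt (m + 1) * qt (l + 1) - qt m * qs l := by
  have ho : qs (m + 1) = qt (m + 1) := by exact_mod_cast h.s_odd_eq_t hm.add_one
  have he := h.s_even_proportional hm
  induction l using Nat.twoStepInduction with
  | zero => simp [h.s_zero, h.t_zero, h.s_one, h.t_one]
  | one =>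
    have h₁ := h.s_add_two m
    have h₂ := h.symm.s_add_two m
    have h₃ := h.s_add_two 0
    have h₄ := h.symm.s_add_two 0
    simp only [zero_add, h.s_zero, h.t_zero, h.s_one, h.t_one] at h₃ h₄
    rw [Nat.cast_one, add_assoc, one_add_one_eq_two, h.s_one, h.t_one]
    exact ⟨by linear_combination h₁ - qs (m + 1) * h₃ - x * ho,
      by linear_combination h₂ - qt (m + 1) * h₄ + y * ho⟩
  | more l ih₁ ih₂ =>
    have h₁ := h.s_add_two (m + l + 1)
    have h₂ := h.symm.s_add_two (m + l + 1)
    have h₃ := h.s_add_two (l + 1)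
    have h₄ := h.symm.s_add_two (l + 1)
    have h₅ := h.s_add_two l
    have h₆ := h.symm.s_add_two l
    push_cast at ih₂ ⊢
    rw [show (m + (l + 1) + 1 : ℤ) = m + l + 1 + 1 by ring] at ih₂
    rw [show (m + (l + 2) + 1 : ℤ) = m + l + 1 + 2 by ring,
      show (l + 2 + 1 : ℤ) = l + 1 + 2 by ring]
    constructor
    · linear_combination h₁ + x * ih₂.2 - ih₁.1 - qs (m + 1) * h₃ + qs m * h₆ + qs (l + 1) * he
        - x * qt (l + 1 + 1) * ho
    · linear_combination h₂ + y * ih₂.1 - ih₁.2 - qt (m + 1) * h₄ + qt m * h₅ - qt (l + 1) * he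
        + y * qs (l + 1 + 1) * ho

/-- Addition formula with an odd first summand, in both colors. -/
theorem add_odd (h : IsTwoColorQuantum x y qs qt) {m : ℕ} (hm : Odd m) (l : ℕ) :
    qs (m + l + 1) = qs (m + 1) * qt (l + 1) - qs m * qs l ∧
    qt (m + l + 1) = qt (m + 1) * qs (l + 1) - qt m * qt l := by
  have ho := h.s_odd_eq_t hm
  have he : y * qs (m + 1) = x * qt (m + 1) := by
    exact_mod_cast h.s_even_proportional hm.add_one
  induction l using Nat.twoStepInduction with
  | zero => simp [h.s_zero, h.t_zero, h.s_one, h.t_one]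
  | one =>
    have h₁ := h.s_add_two m
    have h₂ := h.symm.s_add_two m
    have h₃ := h.s_add_two 0
    have h₄ := h.symm.s_add_two 0
    simp only [zero_add, h.s_zero, h.t_zero, h.s_one, h.t_one] at h₃ h₄
    rw [Nat.cast_one, add_assoc, one_add_one_eq_two, h.s_one, h.t_one]
    exact ⟨by linear_combination h₁ - qs (m + 1) * h₄ - he,
      by linear_combination h₂ - qt (m + 1) * h₃ + he⟩
  | more l ih₁ ih₂ =>
    have h₁ := h.s_add_two (m + l + 1)
    have h₂ := h.symm.s_add_two (m + l + 1)
    have h₃ := h.s_add_two (l + 1)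
    have h₄ := h.symm.s_add_two (l + 1)
    have h₅ := h.s_add_two l
    have h₆ := h.symm.s_add_two l
    push_cast at ih₂ ⊢
    rw [show (m + (l + 1) + 1 : ℤ) = m + l + 1 + 1 by ring] at ih₂
    rw [show (m + (l + 2) + 1 : ℤ) = m + l + 1 + 2 by ring,
      show (l + 2 + 1 : ℤ) = l + 1 + 2 by ring]
    constructor
    · linear_combination h₁ + x * ih₂.2 - ih₁.1 - qs (m + 1) * h₄ + qs m * h₅
        - qs (l + 1 + 1) * he + x * qt (l + 1) * ho
    · linear_combination h₂ + y * ih₂.1 - ih₁.2 - qt (m + 1) * h₃ + qt m * h₆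
        + qt (l + 1 + 1) * he - y * qs (l + 1) * ho

/-- `[m + l]` lies in the ideal generated by `[m]` and `[l]`. -/
theorem exists_add_eq (h : IsTwoColorQuantum x y qs qt) (m l : ℕ) :
    ∃ a b : R, qs (m + l) = a * qs m + b * qs l := by
  have of_even (m l : ℕ) (hm : Even m) : ∃ a b : R, qs (m + l) = a * qs m + b * qs l := by
    cases l with
    | zero => exact ⟨1, 0, by simp⟩
    | succ l =>
      refine ⟨-qt l, qs (m + 1), ?_⟩
      push_cast
      rw [← add_assoc]
      linear_combination (h.add_even hm l).1
  rcases Nat.even_or_odd m with hm | hm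
  · exact of_even m l hm
  rcases Nat.even_or_odd l with hl | hl
  · obtain ⟨a, b, hab⟩ := of_even l m hl
    exact ⟨b, a, by rw [add_comm (m : ℤ), hab, add_comm]⟩
  · have hst := h.s_odd_eq_t hl
    obtain ⟨l, rfl⟩ := Nat.exists_eq_add_one.mpr hl.pos
    refine ⟨-qs l, qs (m + 1), ?_⟩
    push_cast at hst ⊢
    rw [← add_assoc]
    linear_combination (h.add_odd hm l).1 - qs (m + 1) * hst

theorem prod_dvd_prod (h : IsTwoColorQuantum x y qs qt) (n k : ℕ) :
    (∏ i ∈ Finset.range k, qs ((i : ℤ) + 1)) ∣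
      ∏ i ∈ Finset.range k, qs ((n : ℤ) - (i : ℤ)) := by
  induction n generalizing k with
  | zero =>
    cases k with
    | zero => simp
    | succ k => simp [Finset.prod_range_succ', h.s_zero]
  | succ n ih =>
    cases k with
    | zero => simp
    | succ k =>
      have hnum : ∏ i ∈ Finset.range (k + 1), qs (((n + 1 : ℕ) : ℤ) - (i : ℤ)) =
          (∏ i ∈ Finset.range k, qs ((n : ℤ) - (i : ℤ))) * qs (n + 1) := by
        simp [Finset.prod_range_succ']
      rcases lt_or_ge n k with hk | hk
      · rw [hnum, Finset.prod_eq_zero (Finset.mem_range.mpr hk) (by simp [h.s_zero]), zero_mul]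
        exact dvd_zero _
      · obtain ⟨a, b, hab⟩ := h.exists_add_eq (k + 1) (n - k)
        rw [Nat.cast_sub hk, Nat.cast_add_one,
          show (k + 1 + (n - k) : ℤ) = n + 1 by ring] at hab
        have hfirst := mul_dvd_mul_right (ih k) (qs (k + 1))
        have hsecond := ih (k + 1)
        rw [← Finset.prod_range_succ] at hfirst
        rw [Finset.prod_range_succ (fun i : ℕ => qs ((n : ℤ) - (i : ℤ)))] at hsecond
        rw [hnum, hab]
        convert dvd_add (hfirst.mul_left a) (hsecond.mul_left b) using 1
        ring

end IsTwoColorQuantum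


/-- In `ℤ[x_s, x_t]`, for `0 ≤ k ≤ n`, the product `[1]_s·[2]_s·⋯·[k]_s` divides
`[n]_s·[n-1]_s·⋯·[n-k+1]_s`, i.e. the two-colored quantum binomial coefficient
`binom(n,k)_s` lies in `ℤ[x_s, x_t]`; similarly for the coloring `t`. -/
theorem twoColorQuantum_binom_integral (qs qt : ℤ → MvPolynomial (Fin 2) ℤ)
    (hqs0 : qs 0 = 0) (hqt0 : qt 0 = 0) (hqs1 : qs 1 = 1) (hqt1 : qt 1 = 1)
    (hrecs : ∀ n : ℤ, qs (n + 1) = X 0 * qt n - qs (n - 1))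
    (hrect : ∀ n : ℤ, qt (n + 1) = X 1 * qs n - qt (n - 1))
    (k n : ℕ) (hkn : k ≤ n) :
    (∏ i ∈ Finset.range k, qs ((i : ℤ) + 1)) ∣ (∏ i ∈ Finset.range k, qs ((n : ℤ) - (i : ℤ))) ∧
    (∏ i ∈ Finset.range k, qt ((i : ℤ) + 1)) ∣ (∏ i ∈ Finset.range k, qt ((n : ℤ) - (i : ℤ))) := by
  have h : IsTwoColorQuantum (X 0) (X 1) qs qt := ⟨hqs0, hqt0, hqs1, hqt1, hrecs, hrect⟩
  exact ⟨h.prod_dvd_prod n k, h.symm.prod_dvd_prod n k⟩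
end

section
/- Let m ≥ 1 and suppose [m]_s = [m]_t = 0 in K. Then for every integer 0 ≤ k ≤ m: if k is odd, [m−1]_s·[k]_s = [m−k]_s, and if k is even, [m−1]_s·[k]_t = [m−k]_t. -/
/-- If `[m]_s = [m]_t = 0` for some `m ≥ 1`, then for every `0 ≤ k ≤ m`:
if `k` is odd then `[m-1]_s·[k]_s = [m-k]_s`, and if `k` is even then
`[m-1]_s·[k]_t = [m-k]_t`. -/
theorem twoColorQuantum_m_sub_k {K : Type*} [CommRing K] (xs xt : K) (qs qt : ℤ → K)
    (hqs0 : qs 0 = 0) (hqt0 : qt 0 = 0) (hqs1 : qs 1 = 1) (hqt1 : qt 1 = 1)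
    (hrecs : ∀ n : ℤ, qs (n + 1) = xs * qt n - qs (n - 1))
    (hrect : ∀ n : ℤ, qt (n + 1) = xt * qs n - qt (n - 1))
    (m : ℤ) (hm : 1 ≤ m) (hms : qs m = 0) (hmt : qt m = 0) :
    ∀ k : ℤ, 0 ≤ k → k ≤ m →
      (Odd k → qs (m - 1) * qs k = qs (m - k)) ∧
      (Even k → qs (m - 1) * qt k = qt (m - k)) := by
  have key : ∀ n : ℕ, qs (m - 1) * qt (2 * n) = qt (m - 2 * n) ∧
      qs (m - 1) * qs (2 * n + 1) = qs (m - (2 * n + 1)) := by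
    intro n
    induction n with
    | zero => simp [hqt0, hqs1, hmt]
    | succ n ih =>
      obtain ⟨hEven, hOdd⟩ := ih
      have hEven' : qs (m - 1) * qt (2 * n + 2) = qt (m - (2 * n + 2)) := by
        have h₁ := hrect (2 * n + 1)
        have h₂ := hrect (m - (2 * n + 1))
        ring_nf at h₁ h₂ hEven hOdd ⊢
        linear_combination qs (-1 + m) * h₁ - h₂ + xt * hOdd - hEven
      have hOdd' : qs (m - 1) * qs (2 * n + 3) = qs (m - (2 * n + 3)) := by
        have h₁ := hrecs (2 * n + 2)
        have h₂ := hrecs (m - (2 * n + 2))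
        ring_nf at h₁ h₂ hEven' hOdd ⊢
        linear_combination qs (-1 + m) * h₁ - h₂ + xs * hEven' - hOdd
      push_cast
      ring_nf at hEven' hOdd' ⊢
      exact ⟨hEven', hOdd'⟩
  intro k hk _
  lift k to ℕ using hk
  constructor
  · intro h
    obtain ⟨n, rfl⟩ := (Int.odd_coe_nat k).mp h
    exact_mod_cast (key n).2
  · intro h
    obtain ⟨n, rfl⟩ := even_iff_exists_two_mul.mp ((Int.even_coe_nat k).mp h)
    exact_mod_cast (key n).1
end

section
/- Let m ≥ 1 be odd and suppose [m]_s = [m]_t = 0 in K. Then [m−1]_s·[m−1]_t = 1; in particular [m−1]_s and [m−1]_t are units in K. -/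
/-- The two colors agree at odd indices, are proportional at even indices, and consecutive
two-colored quantum numbers lie on a fixed conic. -/
theorem twoColorQuantum_invariants {K : Type*} [CommRing K] (xs xt : K) (qs qt : ℤ → K)
    (hqs0 : qs 0 = 0) (hqt0 : qt 0 = 0) (hqs1 : qs 1 = 1) (hqt1 : qt 1 = 1)
    (hrecs : ∀ n : ℤ, qs (n + 1) = xs * qt n - qs (n - 1))
    (hrect : ∀ n : ℤ, qt (n + 1) = xt * qs n - qt (n - 1)) (k : ℕ) :
    qt (2 * k + 1) = qs (2 * k + 1) ∧ xt * qs (2 * k) = xs * qt (2 * k) ∧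
      qs (2 * k) * qt (2 * k) + qs (2 * k + 1) ^ 2 - xs * qt (2 * k) * qs (2 * k + 1) = 1 := by
  induction k with
  | zero => simp [hqs0, hqt0, hqs1, hqt1]
  | succ k ih =>
    obtain ⟨hodd, heven, hnorm⟩ := ih
    have hs := hrecs (2 * k + 1)
    have ht := hrect (2 * k + 1)
    have hs' := hrecs (2 * k + 1 + 1)
    have ht' := hrect (2 * k + 1 + 1)
    rw [add_sub_cancel_right] at hs ht hs' ht'
    rw [show 2 * ((k + 1 : ℕ) : ℤ) = 2 * k + 1 + 1 by push_cast; ring, hs', ht', hs, ht, hodd]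
    refine ⟨?_, ?_, ?_⟩
    · linear_combination -heven
    · linear_combination -heven
    · linear_combination hnorm - qs (2 * k + 1) * heven

/-- If `m ≥ 1` is odd and `[m]_s = [m]_t = 0`, then `[m-1]_s·[m-1]_t = 1`;
in particular `[m-1]_s` and `[m-1]_t` are units. -/
theorem twoColorQuantum_odd_inverse {K : Type*} [CommRing K] (xs xt : K) (qs qt : ℤ → K)
    (hqs0 : qs 0 = 0) (hqt0 : qt 0 = 0) (hqs1 : qs 1 = 1) (hqt1 : qt 1 = 1)
    (hrecs : ∀ n : ℤ, qs (n + 1) = xs * qt n - qs (n - 1))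
    (hrect : ∀ n : ℤ, qt (n + 1) = xt * qs n - qt (n - 1))
    (m : ℤ) (hm : 1 ≤ m) (hmo : Odd m) (hms : qs m = 0) (hmt : qt m = 0) :
    qs (m - 1) * qt (m - 1) = 1 ∧ IsUnit (qs (m - 1)) ∧ IsUnit (qt (m - 1)) := by
  obtain ⟨j, rfl⟩ := hmo
  obtain ⟨k, rfl⟩ := Int.eq_ofNat_of_zero_le (show 0 ≤ j by omega)
  obtain ⟨-, -, hnorm⟩ :=
    twoColorQuantum_invariants xs xt qs qt hqs0 hqt0 hqs1 hqt1 hrecs hrect k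
  have hmul : qs (2 * (k : ℤ) + 1 - 1) * qt (2 * (k : ℤ) + 1 - 1) = 1 := by
    rw [add_sub_cancel_right]
    simpa [hms] using hnorm
  exact ⟨hmul, .of_mul_eq_one _ hmul, .of_mul_eq_one_right _ hmul⟩
end

section
/- Let m ≥ 2 be even and suppose [m]_s = [m]_t = 0 in K. Then [m−1]_s² = 1 (note [m−1]_s = [m−1]_t since m−1 is odd); in particular [m−1]_s is a unit in K. -/
/-- The relations between consecutive two-colored quantum numbers at an even index `2 * k`:
`[2k+1]_s = [2k+1]_t`, `x_t [2k]_s = x_s [2k]_t`, and the quadratic invariant of the recursion. -/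
theorem twoColorQuantum_even_relations {K : Type*} [CommRing K] (xs xt : K) (qs qt : ℤ → K)
    (hqs0 : qs 0 = 0) (hqt0 : qt 0 = 0) (hqs1 : qs 1 = 1) (hqt1 : qt 1 = 1)
    (hrecs : ∀ n : ℤ, qs (n + 1) = xs * qt n - qs (n - 1))
    (hrect : ∀ n : ℤ, qt (n + 1) = xt * qs n - qt (n - 1)) (k : ℕ) :
    qs (2 * k + 1) = qt (2 * k + 1) ∧ xt * qs (2 * k) = xs * qt (2 * k) ∧
      qs (2 * k + 1) ^ 2 - xs * qs (2 * k + 1) * qt (2 * k) + qs (2 * k) * qt (2 * k) = 1 := by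
  induction k with
  | zero => simp [hqs0, hqt0, hqs1, hqt1]
  | succ k ih =>
    obtain ⟨hodd, heven, hquad⟩ := ih
    have hs := hrecs (2 * k + 1)
    have ht := hrect (2 * k + 1)
    have hs' := hrecs (2 * k + 1 + 1)
    have ht' := hrect (2 * k + 1 + 1)
    simp only [add_sub_cancel_right] at hs ht hs' ht'
    have hidx : (2 * ((k + 1 : ℕ) : ℤ)) = 2 * k + 1 + 1 := by push_cast; ring
    rw [hidx, hs', ht', hs, ht, ← hodd]
    refine ⟨by linear_combination heven, by linear_combination -heven, ?_⟩
    linear_combination hquad - qs (2 * k + 1) * heven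

/-- If `m ≥ 2` is even and `[m]_s = [m]_t = 0`, then `[m-1]_s² = 1`
(note `[m-1]_s = [m-1]_t` since `m-1` is odd); in particular `[m-1]_s` is a unit. -/
theorem twoColorQuantum_even_inverse {K : Type*} [CommRing K] (xs xt : K) (qs qt : ℤ → K)
    (hqs0 : qs 0 = 0) (hqt0 : qt 0 = 0) (hqs1 : qs 1 = 1) (hqt1 : qt 1 = 1)
    (hrecs : ∀ n : ℤ, qs (n + 1) = xs * qt n - qs (n - 1))
    (hrect : ∀ n : ℤ, qt (n + 1) = xt * qs n - qt (n - 1))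
    (m : ℤ) (hm : 2 ≤ m) (hme : Even m) (hms : qs m = 0) (hmt : qt m = 0) :
    qs (m - 1) ^ 2 = 1 ∧ IsUnit (qs (m - 1)) := by
  obtain ⟨j, rfl⟩ := hme
  lift j to ℕ using by omega
  rw [← two_mul] at *
  obtain ⟨-, -, hquad⟩ :=
    twoColorQuantum_even_relations xs xt qs qt hqs0 hqt0 hqs1 hqt1 hrecs hrect j
  have hsq : qs (2 * j - 1) ^ 2 = 1 := by
    rw [hrecs, hms, hmt] at hquad
    linear_combination hquad
  exact ⟨hsq, IsUnit.of_pow_eq_one hsq two_ne_zero⟩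
end

section
/- Let m ≥ 3 be odd and suppose [m]_s = [m]_t = 0 in K. Then [2]_s = x_s and [2]_t = x_t are units in K. -/
/-- If `q (n + 1) = x * r n - q (n - 1)` and `q 1 = 1`, then `q (2k + 1) ≡ (-1)^k` modulo `x`. -/
theorem dvd_odd_sub_neg_one_pow {K : Type*} [CommRing K] {x : K} {q r : ℤ → K}
    (hq1 : q 1 = 1) (hrec : ∀ n : ℤ, q (n + 1) = x * r n - q (n - 1)) (k : ℕ) :
    x ∣ q (2 * k + 1) - (-1) ^ k := by
  induction k with
  | zero => simp [hq1]
  | succ k ih =>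
    obtain ⟨c, hc⟩ := ih
    have h := hrec (2 * (k + 1 : ℕ))
    rw [show (2 * ((k + 1 : ℕ) : ℤ) - 1) = 2 * k + 1 by push_cast; ring] at h
    refine ⟨r (2 * (k + 1 : ℕ)) - c, ?_⟩
    rw [h, pow_succ]
    linear_combination -hc

/-- If `q (n + 1) = x * r n - q (n - 1)`, `q 1 = 1` and `q` vanishes at a positive odd integer,
then `x` is a unit. -/
theorem isUnit_of_odd_eq_zero {K : Type*} [CommRing K] {x : K} {q r : ℤ → K}
    (hq1 : q 1 = 1) (hrec : ∀ n : ℤ, q (n + 1) = x * r n - q (n - 1))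
    {m : ℤ} (hm : 0 < m) (hmo : Odd m) (hqm : q m = 0) : IsUnit x := by
  obtain ⟨k, rfl⟩ := hmo
  lift k to ℕ using by lia
  have h := dvd_odd_sub_neg_one_pow hq1 hrec k
  rw [hqm, zero_sub, dvd_neg] at h
  exact isUnit_of_dvd_unit h (isUnit_one.neg.pow k)

/-- If `m ≥ 3` is odd and `[m]_s = [m]_t = 0`, then `[2]_s = x_s` and `[2]_t = x_t`
are units. -/
theorem twoColorQuantum_two_unit {K : Type*} [CommRing K] (xs xt : K) (qs qt : ℤ → K)
    (hqs0 : qs 0 = 0) (hqt0 : qt 0 = 0) (hqs1 : qs 1 = 1) (hqt1 : qt 1 = 1)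
    (hrecs : ∀ n : ℤ, qs (n + 1) = xs * qt n - qs (n - 1))
    (hrect : ∀ n : ℤ, qt (n + 1) = xt * qs n - qt (n - 1))
    (m : ℤ) (hm : 3 ≤ m) (hmo : Odd m) (hms : qs m = 0) (hmt : qt m = 0) :
    IsUnit xs ∧ IsUnit xt :=
  ⟨isUnit_of_odd_eq_zero hqs1 hrecs (by lia) hmo hms,
    isUnit_of_odd_eq_zero hqt1 hrect (by lia) hmo hmt⟩
end

section
/- Let m ≥ 2 be even and suppose [m]_s = [m]_t = 0 in K. Then for every integer 0 ≤ k ≤ m: [m−1]_s·[k]_s = [m−k]_s and [m−1]_s·[k]_t = [m−k]_t (note [m−1]_s = [m−1]_t since m−1 is odd). -/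
/-- Two-colored quantum numbers agree at odd indices, and `x_t·[n]_s = x_s·[n]_t` at even `n`. -/
theorem twoColorQuantum_odd_eq {K : Type*} [CommRing K] {xs xt : K} {qs qt : ℤ → K}
    (hqs0 : qs 0 = 0) (hqt0 : qt 0 = 0) (hqs1 : qs 1 = 1) (hqt1 : qt 1 = 1)
    (hrecs : ∀ n : ℤ, qs (n + 1) = xs * qt n - qs (n - 1))
    (hrect : ∀ n : ℤ, qt (n + 1) = xt * qs n - qt (n - 1)) (j : ℕ) :
    xt * qs (2 * j) = xs * qt (2 * j) ∧ qs (2 * j + 1) = qt (2 * j + 1) := by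
  induction j with
  | zero => simp [hqs0, hqt0, hqs1, hqt1]
  | succ j ih =>
    obtain ⟨heven, hodd⟩ := ih
    have hs := hrecs (2 * j + 1)
    have ht := hrect (2 * j + 1)
    have hs' := hrecs (2 * j + 2)
    have ht' := hrect (2 * j + 2)
    rw [show (2 * j + 1 + 1 : ℤ) = 2 * j + 2 by ring, add_sub_cancel_right] at hs ht
    rw [show (2 * j + 2 - 1 : ℤ) = 2 * j + 1 by ring] at hs' ht'
    push_cast
    rw [show (2 * (j + 1) : ℤ) = 2 * j + 2 by ring]
    have heven' : xt * qs (2 * j + 2) = xs * qt (2 * j + 2) := by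
      rw [hs, ht, hodd]
      linear_combination -heven
    exact ⟨heven', by rw [hs', ht', heven', hodd]⟩

/-- If `m ≥ 2` is even and `[m]_s = [m]_t = 0`, then for every `0 ≤ k ≤ m`:
`[m-1]_s·[k]_s = [m-k]_s` and `[m-1]_s·[k]_t = [m-k]_t`
(note `[m-1]_s = [m-1]_t` since `m-1` is odd). -/
theorem twoColorQuantum_m_sub_k_even {K : Type*} [CommRing K] (xs xt : K) (qs qt : ℤ → K)
    (hqs0 : qs 0 = 0) (hqt0 : qt 0 = 0) (hqs1 : qs 1 = 1) (hqt1 : qt 1 = 1)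
    (hrecs : ∀ n : ℤ, qs (n + 1) = xs * qt n - qs (n - 1))
    (hrect : ∀ n : ℤ, qt (n + 1) = xt * qs n - qt (n - 1))
    (m : ℤ) (hm : 2 ≤ m) (hme : Even m) (hms : qs m = 0) (hmt : qt m = 0) :
    ∀ k : ℤ, 0 ≤ k → k ≤ m →
      qs (m - 1) * qs k = qs (m - k) ∧ qs (m - 1) * qt k = qt (m - k) := by
  have hodd : qs (m - 1) = qt (m - 1) := by
    obtain ⟨r, rfl⟩ := hme
    obtain ⟨j, hj⟩ := Int.eq_ofNat_of_zero_le (show 0 ≤ r - 1 by lia)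
    rw [show r + r - 1 = 2 * (j : ℤ) + 1 by lia]
    exact (twoColorQuantum_odd_eq hqs0 hqt0 hqs1 hqt1 hrecs hrect j).2
  intro k hk _
  lift k to ℕ using hk
  induction k using Nat.twoStepInduction with
  | zero => simp [hqs0, hqt0, hms, hmt]
  | one => simp [hqs1, hqt1, hodd]
  | more k ih ih' =>
    obtain ⟨hs, ht⟩ := ih (by lia)
    obtain ⟨hs', ht'⟩ := ih' (by lia)
    have hks := hrecs (k + 1)
    have hkt := hrect (k + 1)
    have hmks := hrecs (m - (k + 1))
    have hmkt := hrect (m - (k + 1))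
    rw [show (k + 1 + 1 : ℤ) = k + 2 by ring, add_sub_cancel_right] at hks hkt
    rw [show m - (k + 1 : ℤ) + 1 = m - k by ring,
      show m - (k + 1 : ℤ) - 1 = m - (k + 2) by ring] at hmks hmkt
    push_cast at hs' ht' ⊢
    constructor
    · linear_combination qs (m - 1) * hks + xs * ht' - hs - hmks
    · linear_combination qs (m - 1) * hkt + xt * hs' - ht - hmkt
end

section
/- Let m ≥ 1 be odd and suppose [m]_s = [m]_t = 0 in K. Then for every integer 0 ≤ k ≤ m: [m−1]_s·[k]_t = [m−k]_s and [m−1]_t·[k]_s = [m−k]_t. -/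
/-- Two-colored quantum numbers satisfy `x_t·[2j]_s = x_s·[2j]_t` and `[2j+1]_s = [2j+1]_t`. -/
theorem twoColorQuantum_even_odd_symm {K : Type*} [CommRing K] (xs xt : K) (qs qt : ℤ → K)
    (hqs0 : qs 0 = 0) (hqt0 : qt 0 = 0) (hqs1 : qs 1 = 1) (hqt1 : qt 1 = 1)
    (hrecs : ∀ n : ℤ, qs (n + 1) = xs * qt n - qs (n - 1))
    (hrect : ∀ n : ℤ, qt (n + 1) = xt * qs n - qt (n - 1)) (j : ℕ) :
    xt * qs (2 * j) = xs * qt (2 * j) ∧ qs (2 * j + 1) = qt (2 * j + 1) := by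
  induction j with
  | zero => simp [hqs0, hqt0, hqs1, hqt1]
  | succ j ih =>
    obtain ⟨heven, hodd⟩ := ih
    have hs := hrecs (2 * j + 1)
    have ht := hrect (2 * j + 1)
    have hs' := hrecs (2 * j + 1 + 1)
    have ht' := hrect (2 * j + 1 + 1)
    simp only [add_sub_cancel_right] at hs ht hs' ht'
    push_cast
    rw [show (2 * (j + 1) : ℤ) = 2 * j + 1 + 1 by ring]
    have heven' : xt * qs (2 * j + 1 + 1) = xs * qt (2 * j + 1 + 1) := by
      linear_combination xt * hs - xs * ht - heven - xs * xt * hodd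
    exact ⟨heven', by linear_combination hs' - ht' - heven' - hodd⟩

/-- If `m ≥ 1` is odd and `[m]_s = [m]_t = 0`, then for every `0 ≤ k ≤ m`:
`[m-1]_s·[k]_t = [m-k]_s` and `[m-1]_t·[k]_s = [m-k]_t`. -/
theorem twoColorQuantum_m_sub_k_odd {K : Type*} [CommRing K] (xs xt : K) (qs qt : ℤ → K)
    (hqs0 : qs 0 = 0) (hqt0 : qt 0 = 0) (hqs1 : qs 1 = 1) (hqt1 : qt 1 = 1)
    (hrecs : ∀ n : ℤ, qs (n + 1) = xs * qt n - qs (n - 1))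
    (hrect : ∀ n : ℤ, qt (n + 1) = xt * qs n - qt (n - 1))
    (m : ℤ) (hm : 1 ≤ m) (hmo : Odd m) (hms : qs m = 0) (hmt : qt m = 0) :
    ∀ k : ℤ, 0 ≤ k → k ≤ m →
      qs (m - 1) * qt k = qs (m - k) ∧ qt (m - 1) * qs k = qt (m - k) := by
  obtain ⟨j, rfl⟩ := hmo
  lift j to ℕ using by omega
  have hsymm : xt * qs (2 * j + 1 - 1) = xs * qt (2 * j + 1 - 1) := by
    rw [add_sub_cancel_right]
    exact (twoColorQuantum_even_odd_symm xs xt qs qt hqs0 hqt0 hqs1 hqt1 hrecs hrect j).1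
  generalize (2 * j + 1 : ℤ) = m at *
  intro k hk _
  lift k to ℕ using hk
  suffices h : ∀ k : ℕ,
      (qs (m - 1) * qt k = qs (m - k) ∧ qt (m - 1) * qs k = qt (m - k)) ∧
      (qs (m - 1) * qt (k + 1) = qs (m - (k + 1)) ∧
        qt (m - 1) * qs (k + 1) = qt (m - (k + 1))) from (h k).1
  intro k
  induction k with
  | zero => simp [hqs0, hqt0, hqs1, hqt1, hms, hmt]
  | succ k ih =>
    obtain ⟨⟨hs, ht⟩, hs', ht'⟩ := ih
    push_cast
    refine ⟨⟨hs', ht'⟩, ?_, ?_⟩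
    · have h₁ := hrect (k + 1)
      have h₂ := hrecs (m - (k + 1))
      rw [add_sub_cancel_right] at h₁
      rw [show m - (k + 1 : ℤ) + 1 = m - k by ring,
        show m - (k + 1 : ℤ) - 1 = m - (k + 1 + 1) by ring] at h₂
      linear_combination qs (m - 1) * h₁ - h₂ + xs * ht' - hs + qs (k + 1) * hsymm
    · have h₁ := hrecs (k + 1)
      have h₂ := hrect (m - (k + 1))
      rw [add_sub_cancel_right] at h₁
      rw [show m - (k + 1 : ℤ) + 1 = m - k by ring,
        show m - (k + 1 : ℤ) - 1 = m - (k + 1 + 1) by ring] at h₂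
      linear_combination qt (m - 1) * h₁ - h₂ + xt * hs' - ht - qt (k + 1) * hsymm
end

section
/- Let k ≥ 1 be an integer and suppose [k]_s = [k]_t = 0 in K. Then (σ∘τ)^k is the identity endomorphism of K². -/
/-- The reflection `σ` of `K²` (basis `α_s = (1,0)`, `α_t = (0,1)`):
`σ(α_s) = -α_s`, `σ(α_t) = α_t + x_s·α_s`. -/
def sigV {K : Type*} [CommRing K] (xs : K) : K × K → K × K :=
  fun p => (-p.1 + xs * p.2, p.2)

/-- The reflection `τ` of `K²`: `τ(α_s) = α_s + x_t·α_t`, `τ(α_t) = -α_t`. -/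
def tauV {K : Type*} [CommRing K] (xt : K) : K × K → K × K :=
  fun p => (p.1, xt * p.1 - p.2)

/-- If a two-colored recursive sequence vanishes at `k` in both colors, it is odd about `k`. -/
theorem two_colored_add_eq_neg_sub {K : Type*} [CommRing K] {xs xt : K} {qs qt : ℤ → K}
    (hrecs : ∀ n : ℤ, qs (n + 1) = xs * qt n - qs (n - 1))
    (hrect : ∀ n : ℤ, qt (n + 1) = xt * qs n - qt (n - 1))
    {k : ℤ} (hks : qs k = 0) (hkt : qt k = 0) (j : ℕ) :
    qs (k + j) = -qs (k - j) ∧ qt (k + j) = -qt (k - j) := by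
  induction j using Nat.twoStepInduction with
  | zero => simp [hks, hkt]
  | one =>
    have hs := hrecs k
    have ht := hrect k
    simp_all
  | more j ih₀ ih₁ =>
    have hs := hrecs (k + j + 1)
    have ht := hrect (k + j + 1)
    have hs' := hrecs (k - j - 1)
    have ht' := hrect (k - j - 1)
    push_cast at ih₁ ⊢
    ring_nf at ih₀ ih₁ hs ht hs' ht' ⊢
    constructor
    · linear_combination hs + hs' + xs * ih₁.2 - ih₀.1
    · linear_combination ht + ht' + xt * ih₁.1 - ih₀.2

/-- The entries of the matrix of `(σ∘τ)^n` are two-colored quantum numbers. -/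
theorem sig_tau_iterate_apply {K : Type*} [CommRing K] {xs xt : K} {qs qt : ℤ → K}
    (hqs0 : qs 0 = 0) (hqt0 : qt 0 = 0) (hqs1 : qs 1 = 1) (hqt1 : qt 1 = 1)
    (hrecs : ∀ n : ℤ, qs (n + 1) = xs * qt n - qs (n - 1))
    (hrect : ∀ n : ℤ, qt (n + 1) = xt * qs n - qt (n - 1)) (n : ℕ) (p : K × K) :
    (sigV xs ∘ tauV xt)^[n] p =
      (qs (2 * n + 1) * p.1 - qs (2 * n) * p.2, qt (2 * n) * p.1 - qt (2 * n - 1) * p.2) := by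
  induction n with
  | zero =>
    have ht := hrect 0
    have hneg : qt (-1) = -1 := by
      simp only [zero_add, zero_sub, hqt1, hqs0] at ht
      linear_combination ht
    simp [hqs0, hqt0, hqs1, hneg]
  | succ n ih =>
    have hs₁ := hrecs (2 * n + 1)
    have hs₂ := hrecs (2 * n + 2)
    have ht₀ := hrect (2 * n)
    have ht₁ := hrect (2 * n + 1)
    rw [Function.iterate_succ_apply', ih]
    push_cast
    simp only [Function.comp_apply, sigV, tauV]
    ring_nf at hs₁ hs₂ ht₀ ht₁ ⊢
    ext
    · linear_combination (-p.1) * hs₂ + p.2 * hs₁ - xs * p.1 * ht₁ + xs * p.2 * ht₀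
    · linear_combination (-p.1) * ht₁ + p.2 * ht₀

/-- If `k ≥ 1` and `[k]_s = [k]_t = 0` in `K`, then `(σ∘τ)^k` is the identity
endomorphism of `K²`. -/
theorem sig_tau_pow_eq_id {K : Type*} [CommRing K] (xs xt : K) (qs qt : ℤ → K)
    (hqs0 : qs 0 = 0) (hqt0 : qt 0 = 0) (hqs1 : qs 1 = 1) (hqt1 : qt 1 = 1)
    (hrecs : ∀ n : ℤ, qs (n + 1) = xs * qt n - qs (n - 1))
    (hrect : ∀ n : ℤ, qt (n + 1) = xt * qs n - qt (n - 1))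
    (k : ℕ) (hk : 1 ≤ k) (hks : qs (k : ℤ) = 0) (hkt : qt (k : ℤ) = 0) :
    (sigV xs ∘ tauV xt)^[k] = id := by
  funext p
  have odd_about := two_colored_add_eq_neg_sub hrecs hrect hks hkt
  have hs₀ : qs (2 * k) = 0 := by
    simpa [two_mul, hqs0] using (odd_about k).1
  have ht₀ : qt (2 * k) = 0 := by
    simpa [two_mul, hqt0] using (odd_about k).2
  have hs₁ : qs (2 * k + 1) = 1 := by
    have h := (odd_about (k + 1)).1
    have hneg := hrecs 0
    push_cast at h
    ring_nf at h hneg ⊢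
    linear_combination h - hneg - xs * hqt0 + hqs1
  have ht₁ : qt (2 * k - 1) = -1 := by
    have h := (odd_about (k - 1)).2
    push_cast [hk] at h
    ring_nf at h ⊢
    rw [h, hqt1]
  rw [sig_tau_iterate_apply hqs0 hqt0 hqs1 hqt1 hrecs hrect]
  simp [hs₀, ht₀, hs₁, ht₁]
end

section
/- Let m ≥ 1 be odd and suppose [m]_s = [m]_t = 0 in K. Then π_{t,s} = [m−1]_s·π_{s,t} in the polynomial ring R = K[α_s, α_t]; equivalently (since [m−1]_s·[m−1]_t = 1 in this situation), π_{s,t} = [m−1]_t·π_{t,s}. -/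
open MvPolynomial

/-- The `K`-algebra automorphism `σ` of `R = K[α_s, α_t]` with `σ(α_s) = -α_s` and
`σ(α_t) = α_t + x_s·α_s` (here `α_s = X 0`, `α_t = X 1`). -/
noncomputable def sigP {K : Type*} [CommRing K] (xs : K) :
    MvPolynomial (Fin 2) K →ₐ[K] MvPolynomial (Fin 2) K :=
  aeval (fun i : Fin 2 => if i = 0 then -X 0 else X 1 + C xs * X 0)

/-- The `K`-algebra automorphism `τ` of `R = K[α_s, α_t]` with `τ(α_s) = α_s + x_t·α_t`
and `τ(α_t) = -α_t`. -/
noncomputable def tauP {K : Type*} [CommRing K] (xt : K) :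
    MvPolynomial (Fin 2) K →ₐ[K] MvPolynomial (Fin 2) K :=
  aeval (fun i : Fin 2 => if i = 0 then X 0 + C xt * X 1 else -X 1)

/-- The alternating composite `σ∘τ∘σ∘⋯` of `n` automorphisms, beginning with `σ`. -/
noncomputable def wordST {K : Type*} [CommRing K] (xs xt : K) :
    ℕ → (MvPolynomial (Fin 2) K →ₐ[K] MvPolynomial (Fin 2) K)
  | 0 => AlgHom.id K _
  | n + 1 => (wordST xs xt n).comp (if Even n then sigP xs else tauP xt)

/-- The alternating composite `τ∘σ∘τ∘⋯` of `n` automorphisms, beginning with `τ`. -/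
noncomputable def wordTS {K : Type*} [CommRing K] (xs xt : K) :
    ℕ → (MvPolynomial (Fin 2) K →ₐ[K] MvPolynomial (Fin 2) K)
  | 0 => AlgHom.id K _
  | n + 1 => (wordTS xs xt n).comp (if Even n then tauP xt else sigP xs)

/-- `β_k`: the image of `α_s` (if `k` odd) or `α_t` (if `k` even) under the alternating
composite of `k-1` automorphisms beginning with `σ`. -/
noncomputable def betaP {K : Type*} [CommRing K] (xs xt : K) (k : ℕ) :
    MvPolynomial (Fin 2) K :=
  wordST xs xt (k - 1) (if Odd k then X 0 else X 1)

/-- `γ_k`: the image of `α_t` (if `k` odd) or `α_s` (if `k` even) under the alternating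
composite of `k-1` automorphisms beginning with `τ`. -/
noncomputable def gammaP {K : Type*} [CommRing K] (xs xt : K) (k : ℕ) :
    MvPolynomial (Fin 2) K :=
  wordTS xs xt (k - 1) (if Odd k then X 1 else X 0)

/-- `π_{s,t} = Π_{k=1}^m β_k`. -/
noncomputable def piST {K : Type*} [CommRing K] (xs xt : K) (m : ℕ) :
    MvPolynomial (Fin 2) K :=
  ∏ k ∈ Finset.range m, betaP xs xt (k + 1)

/-- `π_{t,s} = Π_{k=1}^m γ_k`. -/
noncomputable def piTS {K : Type*} [CommRing K] (xs xt : K) (m : ℕ) :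
    MvPolynomial (Fin 2) K :=
  ∏ k ∈ Finset.range m, gammaP xs xt (k + 1)

/-- The sequences `qs`, `qt` are the two-colored quantum numbers attached to `xs`, `xt`. -/
structure IsQuantumPair {K : Type*} [CommRing K] (xs xt : K) (qs qt : ℤ → K) : Prop where
  zero_left : qs 0 = 0
  zero_right : qt 0 = 0
  one_left : qs 1 = 1
  one_right : qt 1 = 1
  rec_left : ∀ n : ℤ, qs (n + 1) = xs * qt n - qs (n - 1)
  rec_right : ∀ n : ℤ, qt (n + 1) = xt * qs n - qt (n - 1)

/-- The linear form `[n]_s·a + [n-1]_t·b`. -/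
noncomputable def quantumRoot {K : Type*} [CommRing K] (qs qt : ℤ → K)
    (a b : MvPolynomial (Fin 2) K) (n : ℤ) : MvPolynomial (Fin 2) K :=
  C (qs n) * a + C (qt (n - 1)) * b

namespace IsQuantumPair

variable {K : Type*} [CommRing K] {xs xt : K} {qs qt : ℤ → K}

theorem symm (h : IsQuantumPair xs xt qs qt) : IsQuantumPair xt xs qt qs :=
  ⟨h.zero_right, h.zero_left, h.one_right, h.one_left, h.rec_right, h.rec_left⟩

theorem left_add_two (h : IsQuantumPair xs xt qs qt) (n : ℤ) :
    qs (n + 2) = xs * qt (n + 1) - qs n := by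
  have := h.rec_left (n + 1)
  rwa [add_assoc, add_sub_cancel_right] at this

theorem left_sub_two (h : IsQuantumPair xs xt qs qt) (n : ℤ) :
    qs (n - 2) = xs * qt (n - 1) - qs n := by
  have := h.left_add_two (n - 2)
  rw [show n - 2 + 2 = n by ring, show n - 2 + 1 = n - 1 by ring] at this
  rw [this]
  ring

theorem right_neg_one (h : IsQuantumPair xs xt qs qt) : qt (-1) = -1 := by
  have := h.symm.left_sub_two 1
  norm_num [h.zero_left, h.one_right] at this
  exact this

theorem parity (h : IsQuantumPair xs xt qs qt) (n : ℕ) :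
    xt * qs (2 * n) = xs * qt (2 * n) ∧ qs (2 * n + 1) = qt (2 * n + 1) := by
  induction n with
  | zero => simp [h.zero_left, h.zero_right, h.one_left, h.one_right]
  | succ n ih =>
    obtain ⟨h₀, h₁⟩ := ih
    have e₂ := h.left_add_two (2 * n)
    have f₂ := h.symm.left_add_two (2 * n)
    have e₃ := h.left_add_two (2 * n + 1)
    have f₃ := h.symm.left_add_two (2 * n + 1)
    rw [show (2 * n + 1 + 1 : ℤ) = 2 * n + 2 by ring] at e₃ f₃
    have key : xt * qs (2 * n + 2) = xs * qt (2 * n + 2) := by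
      rw [e₂, f₂, h₁]
      linear_combination -h₀
    rw [show (2 * (n + 1 : ℕ) : ℤ) = 2 * n + 2 by push_cast; ring]
    refine ⟨key, ?_⟩
    rw [show (2 * n + 2 + 1 : ℤ) = 2 * n + 1 + 2 by ring, e₃, f₃, h₁, key]

theorem mul_left_of_even (h : IsQuantumPair xs xt qs qt) {n : ℕ} (hn : Even n) :
    xt * qs n = xs * qt n := by
  obtain ⟨k, rfl⟩ := hn.exists_two_nsmul
  simpa using (h.parity k).1

theorem left_eq_right_of_odd (h : IsQuantumPair xs xt qs qt) {n : ℕ} (hn : Odd n) :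
    qs n = qt n := by
  obtain ⟨k, rfl⟩ := hn
  simpa using (h.parity k).2

theorem quantumRoot_zero (h : IsQuantumPair xs xt qs qt) (a b : MvPolynomial (Fin 2) K) :
    quantumRoot qs qt a b 0 = -b := by
  simp [quantumRoot, h.zero_left, h.right_neg_one]

theorem quantumRoot_one (h : IsQuantumPair xs xt qs qt) (a b : MvPolynomial (Fin 2) K) :
    quantumRoot qs qt a b 1 = a := by
  simp [quantumRoot, h.one_left, h.zero_right]

theorem quantumRoot_add_two (h : IsQuantumPair xs xt qs qt) (a b : MvPolynomial (Fin 2) K)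
    (n : ℕ) : quantumRoot qs qt a b (n + 2) =
      C (if Even n then xs else xt) * quantumRoot qs qt a b (n + 1) - quantumRoot qs qt a b n := by
  have e := h.left_add_two n
  have f := h.symm.left_add_two (n - 1)
  rw [show (n - 1 + 2 : ℤ) = n + 1 by ring, sub_add_cancel] at f
  simp only [quantumRoot, show (n + 2 - 1 : ℤ) = n + 1 by ring, add_sub_cancel_right]
  split_ifs with hn
  · have p := h.left_eq_right_of_odd hn.add_one
    push_cast at p
    rw [← p] at e
    rw [h.mul_left_of_even hn] at f
    simp only [e, f, map_sub, map_mul]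
    ring
  · rw [Nat.not_even_iff_odd] at hn
    have p := h.mul_left_of_even hn.add_one
    push_cast at p
    rw [← p] at e
    rw [h.left_eq_right_of_odd hn] at f
    simp only [e, f, map_sub, map_mul]
    ring

theorem wordST_X (h : IsQuantumPair xs xt qs qt) (n : ℕ) :
    wordST xs xt n (if Even n then X 0 else X 1) = quantumRoot qs qt (X 0) (X 1) (n + 1) ∧
    wordST xs xt n (if Even n then X 1 else X 0) = -quantumRoot qs qt (X 0) (X 1) n := by
  induction n with
  | zero => simp [wordST, h.quantumRoot_zero, h.quantumRoot_one]
  | succ n ih =>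
    obtain ⟨h₁, h₂⟩ := ih
    have e := h.quantumRoot_add_two (X 0) (X 1) n
    push_cast
    rw [show (n + 1 + 1 : ℤ) = n + 2 by ring, e]
    by_cases hn : Even n <;>
      simp only [hn, if_true, if_false] at h₁ h₂ <;>
      simp [hn, wordST, sigP, tauP, Nat.even_add_one, algHom_C, algebraMap_eq, h₁, h₂] <;> ring

theorem wordTS_X (h : IsQuantumPair xs xt qs qt) (n : ℕ) :
    wordTS xs xt n (if Even n then X 1 else X 0) = quantumRoot qt qs (X 1) (X 0) (n + 1) ∧
    wordTS xs xt n (if Even n then X 0 else X 1) = -quantumRoot qt qs (X 1) (X 0) n := by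
  induction n with
  | zero => simp [wordTS, h.symm.quantumRoot_zero, h.symm.quantumRoot_one]
  | succ n ih =>
    obtain ⟨h₁, h₂⟩ := ih
    have e := h.symm.quantumRoot_add_two (X 1) (X 0) n
    push_cast
    rw [show (n + 1 + 1 : ℤ) = n + 2 by ring, e]
    by_cases hn : Even n <;>
      simp only [hn, if_true, if_false] at h₁ h₂ <;>
      simp [hn, wordTS, sigP, tauP, Nat.even_add_one, algHom_C, algebraMap_eq, h₁, h₂] <;> ring

theorem betaP_add_one (h : IsQuantumPair xs xt qs qt) (n : ℕ) :
    betaP xs xt (n + 1) = C (qs (n + 1)) * X 0 + C (qt n) * X 1 := by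
  simpa [betaP, Nat.odd_add_one, quantumRoot] using (h.wordST_X n).1

theorem gammaP_add_one (h : IsQuantumPair xs xt qs qt) (n : ℕ) :
    gammaP xs xt (n + 1) = C (qs n) * X 0 + C (qt (n + 1)) * X 1 := by
  simpa [gammaP, Nat.odd_add_one, quantumRoot, add_comm] using (h.wordTS_X n).1

theorem reflect (h : IsQuantumPair xs xt qs qt) {m : ℤ} (hm : qs m = 0) (n : ℕ) :
    qs (m - 2 * n) = qt (m - 1) * qs (2 * n) ∧
    qt (m - (2 * n + 1)) = qt (m - 1) * qt (2 * n + 1) := by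
  induction n with
  | zero => simp [hm, h.zero_left, h.one_right]
  | succ n ih =>
    obtain ⟨h₀, h₁⟩ := ih
    have e₂ := h.left_sub_two (m - 2 * n)
    have f₂ := h.left_add_two (2 * n)
    have e₃ := h.symm.left_sub_two (m - (2 * n + 1))
    have f₃ := h.symm.left_add_two (2 * n + 1)
    rw [show m - 2 * n - 2 = m - (2 * n + 2) by ring,
      show m - 2 * n - 1 = m - (2 * n + 1) by ring] at e₂
    rw [show m - (2 * n + 1) - 2 = m - (2 * n + 2 + 1) by ring,
      show m - (2 * n + 1) - 1 = m - (2 * n + 2) by ring] at e₃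
    rw [show (2 * n + 1 + 1 : ℤ) = 2 * n + 2 by ring,
      show (2 * n + 1 + 2 : ℤ) = 2 * n + 2 + 1 by ring] at f₃
    have key : qs (m - (2 * n + 2)) = qt (m - 1) * qs (2 * n + 2) := by
      rw [e₂, f₂, h₀, h₁]
      ring
    rw [show (2 * (n + 1 : ℕ) : ℤ) = 2 * n + 2 by push_cast; ring]
    refine ⟨key, ?_⟩
    rw [e₃, f₃, key, h₁]
    ring

theorem reflect_mul_reflect (h : IsQuantumPair xs xt qs qt) {m : ℕ} (hmo : Odd m)
    (hms : qs m = 0) : qs (m - 1) * qt (m - 1) = 1 := by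
  obtain ⟨n, rfl⟩ := hmo
  have := (h.reflect hms n).1
  push_cast at this ⊢
  rw [add_sub_cancel_left, h.one_left] at this
  rw [this, add_sub_cancel_right]
  ring

theorem betaP_reflect (h : IsQuantumPair xs xt qs qt) {m k : ℕ} (hms : qs m = 0)
    (hmt : qt m = 0) (hk : k < m) :
    betaP xs xt (m - 1 - k + 1) =
      C (if Even k then qt (m - 1) else qs (m - 1)) * gammaP xs xt (k + 1) := by
  rw [h.betaP_add_one, h.gammaP_add_one,
    show ((m - 1 - k : ℕ) : ℤ) = m - (k + 1) by omega,
    show (m - (k + 1) + 1 : ℤ) = m - k by ring]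
  rcases Nat.even_or_odd' k with ⟨n, rfl | rfl⟩
  · obtain ⟨h₀, h₁⟩ := h.reflect hms n
    push_cast
    simp only [even_two_mul, if_true, h₀, h₁, map_mul]
    ring
  · have h₁ := (h.symm.reflect hmt n).2
    have h₂ := (h.symm.reflect hmt (n + 1)).1
    push_cast at h₂ ⊢
    rw [show (2 * (n + 1) : ℤ) = 2 * n + 1 + 1 by ring] at h₂
    simp only [Nat.not_even_two_mul_add_one, if_false, h₁, h₂, map_mul]
    ring

end IsQuantumPair

theorem prod_range_alternating_of_mul_eq_one {M : Type*} [CommMonoid M] {u v : M}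
    (huv : u * v = 1) (n : ℕ) :
    ∏ k ∈ Finset.range (2 * n + 1), (if Even k then v else u) = v := by
  induction n with
  | zero => simp
  | succ n ih =>
    rw [show 2 * (n + 1) + 1 = 2 * n + 1 + 1 + 1 by ring, Finset.prod_range_succ,
      Finset.prod_range_succ, ih]
    simp [Nat.even_add_one, mul_comm v u, huv]

/-- If `m ≥ 1` is odd and `[m]_s = [m]_t = 0` in `K`, then
`π_{t,s} = [m-1]_s·π_{s,t}`; equivalently `π_{s,t} = [m-1]_t·π_{t,s}`. -/
theorem piTS_eq_smul_piST_of_odd {K : Type*} [CommRing K] (xs xt : K) (qs qt : ℤ → K)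
    (hqs0 : qs 0 = 0) (hqt0 : qt 0 = 0) (hqs1 : qs 1 = 1) (hqt1 : qt 1 = 1)
    (hrecs : ∀ n : ℤ, qs (n + 1) = xs * qt n - qs (n - 1))
    (hrect : ∀ n : ℤ, qt (n + 1) = xt * qs n - qt (n - 1))
    (m : ℕ) (hm : 1 ≤ m) (hmo : Odd m) (hms : qs (m : ℤ) = 0) (hmt : qt (m : ℤ) = 0) :
    piTS xs xt m = MvPolynomial.C (qs ((m : ℤ) - 1)) * piST xs xt m ∧
    piST xs xt m = MvPolynomial.C (qt ((m : ℤ) - 1)) * piTS xs xt m := by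
  have h : IsQuantumPair xs xt qs qt := ⟨hqs0, hqt0, hqs1, hqt1, hrecs, hrect⟩
  have huv := h.reflect_mul_reflect hmo hms
  have key : piST xs xt m = C (qt ((m : ℤ) - 1)) * piTS xs xt m := by
    rw [piST, ← Finset.prod_range_reflect, Finset.prod_congr rfl fun k hk =>
      h.betaP_reflect hms hmt (Finset.mem_range.1 hk), Finset.prod_mul_distrib, ← map_prod, piTS]
    obtain ⟨n, rfl⟩ := hmo
    rw [prod_range_alternating_of_mul_eq_one huv]
  refine ⟨?_, key⟩
  rw [key, ← mul_assoc, ← map_mul, huv, map_one, one_mul]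
end

section
/- Let m ≥ 1 and suppose [m]_t = 0 in K. Then [m−1]_s·σ(π_{s,t}) = −π_{t,s} in the polynomial ring R = K[α_s, α_t]. -/
open MvPolynomial

section Reflections

variable {K : Type*} [CommRing K] (xs xt : K)

lemma sigP_X_zero : sigP xs (X 0) = -X 0 := by simp [sigP]

lemma sigP_X_one : sigP xs (X 1) = X 1 + C xs * X 0 := by simp [sigP]

lemma tauP_X_zero : tauP xt (X 0) = X 0 + C xt * X 1 := by simp [tauP]

lemma tauP_X_one : tauP xt (X 1) = -X 1 := by simp [tauP]

lemma sigP_sigP (p : MvPolynomial (Fin 2) K) : sigP xs (sigP xs p) = p := by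
  have h : (sigP xs).comp (sigP xs) = AlgHom.id K _ := by
    ext i : 1
    fin_cases i
    · simp [sigP_X_zero]
    · simp [sigP_X_zero, sigP_X_one, algHom_C, algebraMap_eq]
  exact DFunLike.congr_fun h p

lemma wordST_succ (n : ℕ) : wordST xs xt (n + 1) = (sigP xs).comp (wordTS xs xt n) := by
  induction n with
  | zero => simp [wordST, wordTS]
  | succ n ih =>
    rw [wordST, ih, wordTS, AlgHom.comp_assoc]
    by_cases h : Even n <;> simp [h, Nat.even_add_one]

lemma wordTS_succ (n : ℕ) : wordTS xs xt (n + 1) = (tauP xt).comp (wordST xs xt n) := by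
  induction n with
  | zero => simp [wordST, wordTS]
  | succ n ih =>
    rw [wordTS, ih, wordST, AlgHom.comp_assoc]
    by_cases h : Even n <;> simp [h, Nat.even_add_one]

lemma betaP_one : betaP xs xt 1 = X 0 := by simp [betaP, wordST]

lemma gammaP_one : gammaP xs xt 1 = X 1 := by simp [gammaP, wordTS]

lemma betaP_add_two (n : ℕ) : betaP xs xt (n + 2) = sigP xs (gammaP xs xt (n + 1)) := by
  by_cases h : Even n <;> simp [betaP, gammaP, wordST_succ, h, parity_simps, ← Nat.not_even_iff_odd]

lemma gammaP_add_two (n : ℕ) : gammaP xs xt (n + 2) = tauP xt (betaP xs xt (n + 1)) := by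
  by_cases h : Even n <;> simp [betaP, gammaP, wordTS_succ, h, parity_simps, ← Nat.not_even_iff_odd]

/-- The roots `β_k` and `γ_k` have two-colored quantum numbers as coefficients. -/
lemma betaP_gammaP_eq (qs qt : ℤ → K)
    (hqs0 : qs 0 = 0) (hqt0 : qt 0 = 0) (hqs1 : qs 1 = 1) (hqt1 : qt 1 = 1)
    (hrecs : ∀ n : ℤ, qs (n + 1) = xs * qt n - qs (n - 1))
    (hrect : ∀ n : ℤ, qt (n + 1) = xt * qs n - qt (n - 1)) (n : ℕ) :
    betaP xs xt (n + 1) = C (qs (n + 1)) * X 0 + C (qt n) * X 1 ∧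
      gammaP xs xt (n + 1) = C (qt (n + 1)) * X 1 + C (qs n) * X 0 := by
  induction n with
  | zero => simp [betaP_one, gammaP_one, hqs0, hqt0, hqs1, hqt1]
  | succ n ih =>
    have hs := hrecs (n + 1)
    have ht := hrect (n + 1)
    rw [add_sub_cancel_right] at hs ht
    constructor
    · rw [betaP_add_two, ih.2]
      push_cast
      simp only [hs, map_add, map_mul, map_sub, algHom_C, algebraMap_eq, sigP_X_zero, sigP_X_one]
      ring
    · rw [gammaP_add_two, ih.1]
      push_cast
      simp only [ht, map_add, map_mul, map_sub, algHom_C, algebraMap_eq, tauP_X_zero, tauP_X_one]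
      ring

lemma piTS_succ (n : ℕ) : piTS xs xt (n + 1) = piTS xs xt n * gammaP xs xt (n + 1) :=
  Finset.prod_range_succ _ _

lemma sigP_piST_succ (n : ℕ) : sigP xs (piST xs xt (n + 1)) = -X 0 * piTS xs xt n := by
  simp only [piST, piTS, Finset.prod_range_succ', map_mul, map_prod, zero_add, betaP_one,
    sigP_X_zero, betaP_add_two, sigP_sigP, mul_comm, add_assoc, one_add_one_eq_two]

end Reflections

/-- If `m ≥ 1` and `[m]_t = 0` in `K`, then `[m-1]_s·σ(π_{s,t}) = -π_{t,s}`
in `R = K[α_s, α_t]`. -/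
theorem smul_sig_piST_eq_neg_piTS {K : Type*} [CommRing K] (xs xt : K) (qs qt : ℤ → K)
    (hqs0 : qs 0 = 0) (hqt0 : qt 0 = 0) (hqs1 : qs 1 = 1) (hqt1 : qt 1 = 1)
    (hrecs : ∀ n : ℤ, qs (n + 1) = xs * qt n - qs (n - 1))
    (hrect : ∀ n : ℤ, qt (n + 1) = xt * qs n - qt (n - 1))
    (m : ℕ) (hm : 1 ≤ m) (hmt : qt (m : ℤ) = 0) :
    MvPolynomial.C (qs ((m : ℤ) - 1)) * sigP xs (piST xs xt m) = -piTS xs xt m := by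
  obtain ⟨n, rfl⟩ := Nat.exists_eq_add_of_le' hm
  have hγ := (betaP_gammaP_eq xs xt qs qt hqs0 hqt0 hqs1 hqt1 hrecs hrect n).2
  push_cast at hmt ⊢
  rw [sigP_piST_succ, piTS_succ, hγ, hmt, add_sub_cancel_right, C_0]
  ring
end
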